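/- arXiv:2604.07400 — 7 statements merged into one kernel-verified Lean document; each statement's English description precedes it below -/
import Mathlib

section
/- Let a, b, c : ℂ → ℂ be differentiable at ω ∈ ℂ, and suppose that none of c(ω), c(ω)−a(ω)−b(ω), c(ω)−a(ω), c(ω)−b(ω) is a non-positive integer. Define C_slow(ω) := Γ(c(ω))·Γ(c(ω)−a(ω)−b(ω))/(Γ(c(ω)−a(ω))·Γ(c(ω)−b(ω))) and ψ(s) := deriv Γ(s)/Γ(s). Then C_slow is differentiable at ω with deriv C_slow(ω) = C_slow(ω)·[c'(ω)·ψ(c(ω)) + (c'(ω)−a'(ω)−b'(ω))·ψ(c(ω)−a(ω)−b(ω)) − (c'(ω)−a'(ω))·ψ(c(ω)−a(ω)) − (c'(ω)−b'(ω))·ψ(c(ω)−b(ω))]. -/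
/-- The Digamma function `ψ = Γ'/Γ`, the logarithmic derivative of the complex
Gamma function. -/
noncomputable def digamma (s : ℂ) : ℂ := deriv Complex.Gamma s / Complex.Gamma s

/-- Closed-form Digamma derivative of the Kummer connection coefficient
`C_slow = Γ(c)Γ(c−a−b)/(Γ(c−a)Γ(c−b))`, Eq. (25) of the paper. -/
theorem deriv_C_slow (a b c : ℂ → ℂ) (ω : ℂ)
    (ha : DifferentiableAt ℂ a ω) (hb : DifferentiableAt ℂ b ω)
    (hc : DifferentiableAt ℂ c ω)
    (h1 : ∀ n : ℕ, c ω ≠ -n)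
    (h2 : ∀ n : ℕ, c ω - a ω - b ω ≠ -n)
    (h3 : ∀ n : ℕ, c ω - a ω ≠ -n)
    (h4 : ∀ n : ℕ, c ω - b ω ≠ -n) :
    DifferentiableAt ℂ (fun ω => Complex.Gamma (c ω) * Complex.Gamma (c ω - a ω - b ω) /
      (Complex.Gamma (c ω - a ω) * Complex.Gamma (c ω - b ω))) ω ∧
    deriv (fun ω => Complex.Gamma (c ω) * Complex.Gamma (c ω - a ω - b ω) /
      (Complex.Gamma (c ω - a ω) * Complex.Gamma (c ω - b ω))) ω =
      (Complex.Gamma (c ω) * Complex.Gamma (c ω - a ω - b ω) /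
        (Complex.Gamma (c ω - a ω) * Complex.Gamma (c ω - b ω))) *
      (deriv c ω * digamma (c ω)
        + (deriv c ω - deriv a ω - deriv b ω) * digamma (c ω - a ω - b ω)
        - (deriv c ω - deriv a ω) * digamma (c ω - a ω)
        - (deriv c ω - deriv b ω) * digamma (c ω - b ω)) := by
  have key : ∀ (f : ℂ → ℂ) (df : ℂ), HasDerivAt f df ω → (∀ n : ℕ, f ω ≠ -n) →
      HasDerivAt (fun w => Complex.Gamma (f w))
        (Complex.Gamma (f ω) * (df * digamma (f ω))) ω := by
    intro f df hf h
    have hne := Complex.Gamma_ne_zero h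
    have := (Complex.differentiableAt_Gamma _ h).hasDerivAt.comp ω hf
    refine this.congr_deriv ?_
    unfold digamma
    field_simp
  have n3 := Complex.Gamma_ne_zero h3
  have n4 := Complex.Gamma_ne_zero h4
  have d1 := key c _ hc.hasDerivAt h1
  have d2 := key (fun w => c w - a w - b w) _
    ((hc.hasDerivAt.fun_sub ha.hasDerivAt).fun_sub hb.hasDerivAt) h2
  have d3 := key (fun w => c w - a w) _ (hc.hasDerivAt.fun_sub ha.hasDerivAt) h3
  have d4 := key (fun w => c w - b w) _ (hc.hasDerivAt.fun_sub hb.hasDerivAt) h4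
  have d := (d1.fun_mul d2).fun_div (d3.fun_mul d4) (mul_ne_zero n3 n4)
  refine ⟨d.differentiableAt, d.deriv.trans ?_⟩
  generalize digamma (c ω) = p1
  generalize digamma (c ω - a ω - b ω) = p2
  generalize digamma (c ω - a ω) = p3
  generalize digamma (c ω - b ω) = p4
  generalize Complex.Gamma (c ω - a ω) = g3 at *
  generalize Complex.Gamma (c ω - b ω) = g4 at *
  field_simp
  ring
end

section
/- Let r₊ > r₋ ≥ 0 with r₊ > 0, let m, μ ∈ ℝ, set ν := √(1+μ²) and h := (1+ν)/2. For ω ∈ ℂ define ρ₀ := −i(ω·r₊ − m·r₋)/(2(r₊² − r₋²)), ρ₁ := (1−ν)/2, X := (ω·r₋ − m·r₊)/(2(r₊² − r₋²)), a := ρ₀ + ρ₁ + iX, b := ρ₀ + ρ₁ − iX, c := 1 + 2ρ₀. If Γ(c) ≠ 0, then Γ(c)·Γ(c−a−b)/(Γ(c−a)·Γ(c−b)) = 0 if and only if there exists a natural number n such that ω = m − 2i(r₊ − r₋)(n + h) or ω = −m − 2i(r₊ + r₋)(n + h). -/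
/-- BTZ benchmark: the Dirichlet quantization function built from the
hypergeometric parameters (Eq. 38) of the massive scalar on the rotating BTZ
black hole vanishes exactly at the left- and right-moving quasinormal frequencies. -/
theorem btz_quasinormal_spectrum (rp rm m μ : ℝ)
    (hrm : 0 ≤ rm) (hlt : rm < rp) (hrp : 0 < rp) (ω : ℂ) :
    let ν : ℝ := Real.sqrt (1 + μ ^ 2)
    let h : ℝ := (1 + ν) / 2
    let ρ₀ : ℂ := -Complex.I * (ω * rp - m * rm) / (2 * (rp ^ 2 - rm ^ 2))
    let ρ₁ : ℂ := (1 - (ν : ℂ)) / 2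
    let X : ℂ := (ω * rm - m * rp) / (2 * (rp ^ 2 - rm ^ 2))
    let a : ℂ := ρ₀ + ρ₁ + Complex.I * X
    let b : ℂ := ρ₀ + ρ₁ - Complex.I * X
    let c : ℂ := 1 + 2 * ρ₀
    Complex.Gamma c ≠ 0 →
      (Complex.Gamma c * Complex.Gamma (c - a - b) /
          (Complex.Gamma (c - a) * Complex.Gamma (c - b)) = 0 ↔
        ∃ n : ℕ, ω = m - 2 * Complex.I * (rp - rm) * (n + h) ∨
          ω = -m - 2 * Complex.I * (rp + rm) * (n + h)) := by
  intro ν h ρ₀ ρ₁ X a b c hc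
  have hν : 0 < ν := Real.sqrt_pos.mpr (by positivity)
  have hp : (rp : ℂ) + rm ≠ 0 := by
    have : rp + rm ≠ 0 := by linarith
    exact_mod_cast this
  have hm : (rp : ℂ) - rm ≠ 0 := by
    have : rp - rm ≠ 0 := by linarith
    exact_mod_cast this
  have hD : (rp : ℂ) ^ 2 - rm ^ 2 = (rp + rm) * (rp - rm) := by ring
  have hh : (h : ℂ) = (1 + (ν : ℂ)) / 2 := by simp [h]
  have e0 : c - a - b = (ν : ℂ) := by
    simp only [c, a, b, ρ₁]; ring
  have e1 : c - a = h - Complex.I * (ω - m) / (2 * (rp - rm)) := by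
    rw [hh]
    simp only [c, a, ρ₁, ρ₀, X, hD]
    field_simp
    ring
  have e2 : c - b = h - Complex.I * (ω + m) / (2 * (rp + rm)) := by
    rw [hh]
    simp only [c, b, ρ₁, ρ₀, X, hD]
    field_simp
    ring
  have hG : Complex.Gamma (c - a - b) ≠ 0 := by
    rw [e0]
    exact Complex.Gamma_ne_zero_of_re_pos (by simpa using hν)
  have key : ∀ (z d : ℂ) (n : ℕ), d ≠ 0 →
      ((h : ℂ) - Complex.I * z / (2 * d) = -n ↔ z = - (2 * Complex.I * d * (n + h))) := by
    intro z d n hd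
    have hI : Complex.I * Complex.I = -1 := Complex.I_mul_I
    constructor
    · intro H
      have H2 : Complex.I * z = 2 * d * (n + h) := by
        have : Complex.I * z / (2 * d) = n + h := by linear_combination -H
        rw [div_eq_iff (by simpa using hd)] at this
        rw [this]; ring
      linear_combination (-Complex.I) * H2 + z * hI
    · intro H
      have : Complex.I * z / (2 * d) = n + h := by
        rw [div_eq_iff (by simpa using hd), H]
        linear_combination (-2 * d * (n + h)) * hI
      rw [this]; ring
  rw [div_eq_zero_iff, or_iff_right (mul_ne_zero hc hG), mul_eq_zero,
    Complex.Gamma_eq_zero_iff, Complex.Gamma_eq_zero_iff, ← exists_or]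
  refine exists_congr fun n => ?_
  rw [e1, e2, key _ _ n hm, key _ _ n hp]
  refine or_congr ⟨fun H => ?_, fun H => ?_⟩ ⟨fun H => ?_, fun H => ?_⟩ <;>
    linear_combination H
end

section
/- Let a, b, c : ℂ → ℂ be differentiable at ω₀ ∈ ℂ and let n be a natural number with c(ω₀) − a(ω₀) = −n. Suppose none of c(ω₀), c(ω₀)−a(ω₀)−b(ω₀), c(ω₀)−b(ω₀) is a non-positive integer. Define F(ω) := Γ(c(ω))·Γ(c(ω)−a(ω)−b(ω))·(Γ(c(ω)−a(ω)))⁻¹·(Γ(c(ω)−b(ω)))⁻¹. Then F(ω₀) = 0 and deriv F(ω₀) = (Γ(c(ω₀))·Γ(c(ω₀)−a(ω₀)−b(ω₀))/Γ(c(ω₀)−b(ω₀)))·(−1)ⁿ·n!·(c'(ω₀) − a'(ω₀)). -/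
theorem hasDerivAt_inv_Gamma_neg_nat (n : ℕ) :
    HasDerivAt (fun s : ℂ => (Complex.Gamma s)⁻¹) ((-1) ^ n * (n.factorial : ℂ)) (-(n : ℂ)) := by
  have key : (fun s : ℂ => (Complex.Gamma s)⁻¹) = fun s => s * (Complex.Gamma (s + 1))⁻¹ :=
    funext Complex.one_div_Gamma_eq_self_mul_one_div_Gamma_add_one
  induction n with
  | zero =>
    rw [key]
    have h := (Complex.differentiable_one_div_Gamma ((-((0 : ℕ) : ℂ)) + 1)).hasDerivAt
    have h' := (hasDerivAt_id (-((0 : ℕ) : ℂ))).mul (h.comp_add_const _ 1)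
    refine h'.congr_deriv ?_
    simp
  | succ n ih =>
    rw [key]
    have e : -((n + 1 : ℕ) : ℂ) + 1 = -(n : ℂ) := by push_cast; ring
    rw [← e] at ih
    have h' := (hasDerivAt_id (-((n + 1 : ℕ) : ℂ))).mul (ih.comp_add_const _ 1)
    refine h'.congr_deriv ?_
    rw [e, Complex.Gamma_neg_nat_eq_zero, Nat.factorial_succ]
    simp only [id]
    push_cast
    ring

/-- Derivative of the Dirichlet quantization function at a spectral root of the
branch `c − a = −n` (Eq. 47): `F(ω₀) = 0` and
`F'(ω₀) = (Γ(c)Γ(c−a−b)/Γ(c−b))·(−1)ⁿ·n!·(c' − a')`. -/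
theorem deriv_quantization_at_root (a b c : ℂ → ℂ) (ω₀ : ℂ) (n : ℕ)
    (ha : DifferentiableAt ℂ a ω₀) (hb : DifferentiableAt ℂ b ω₀)
    (hc : DifferentiableAt ℂ c ω₀)
    (hroot : c ω₀ - a ω₀ = -(n : ℂ))
    (h1 : ∀ k : ℕ, c ω₀ ≠ -(k : ℂ))
    (h2 : ∀ k : ℕ, c ω₀ - a ω₀ - b ω₀ ≠ -(k : ℂ))
    (h3 : ∀ k : ℕ, c ω₀ - b ω₀ ≠ -(k : ℂ)) :
    (fun ω => Complex.Gamma (c ω) * Complex.Gamma (c ω - a ω - b ω) *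
        (Complex.Gamma (c ω - a ω))⁻¹ * (Complex.Gamma (c ω - b ω))⁻¹) ω₀ = 0 ∧
    deriv (fun ω => Complex.Gamma (c ω) * Complex.Gamma (c ω - a ω - b ω) *
        (Complex.Gamma (c ω - a ω))⁻¹ * (Complex.Gamma (c ω - b ω))⁻¹) ω₀ =
      (Complex.Gamma (c ω₀) * Complex.Gamma (c ω₀ - a ω₀ - b ω₀) /
          Complex.Gamma (c ω₀ - b ω₀)) *
        ((-1) ^ n * (n.factorial : ℂ) * (deriv c ω₀ - deriv a ω₀)) := by
  have hz : (Complex.Gamma (c ω₀ - a ω₀))⁻¹ = 0 := by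
    rw [hroot, Complex.Gamma_neg_nat_eq_zero, inv_zero]
  refine ⟨by simp only [hz]; ring, ?_⟩
  have hG := hasDerivAt_inv_Gamma_neg_nat n
  rw [← hroot] at hG
  have d1 := ((Complex.differentiableAt_Gamma _ h1).comp ω₀ hc).hasDerivAt
  have d2 := ((Complex.differentiableAt_Gamma _ h2).comp ω₀ ((hc.sub ha).sub hb)).hasDerivAt
  have d3 := hG.comp ω₀ (hc.hasDerivAt.sub ha.hasDerivAt)
  have d4 := ((Complex.differentiable_one_div_Gamma (c ω₀ - b ω₀)).comp ω₀ (hc.sub hb)).hasDerivAt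
  have d := ((d1.mul d2).mul d3).mul d4
  refine (d.congr_deriv ?_).deriv
  simp only [Function.comp_apply, Pi.mul_apply, Pi.sub_apply, hz]
  ring
end

section
/- Let a, b, c : ℂ → ℂ be differentiable at ω₀ ∈ ℂ and let n be a natural number with c(ω₀) − a(ω₀) = −n. Suppose none of c(ω₀), c(ω₀)−a(ω₀)−b(ω₀), c(ω₀)−b(ω₀), a(ω₀), b(ω₀), a(ω₀)+b(ω₀)−c(ω₀) is a non-positive integer, and suppose c'(ω₀) − a'(ω₀) ≠ 0. Define F(ω) := Γ(c)·Γ(c−a−b)·(Γ(c−a))⁻¹·(Γ(c−b))⁻¹ and C_fast(ω) := Γ(c)·Γ(a+b−c)/(Γ(a)·Γ(b)), all evaluated along the maps a, b, c. Then the excitation amplitude factor satisfies 1/(C_fast(ω₀)·deriv F(ω₀)) = (Γ(a)·Γ(b)·Γ(c−b))/(Γ(c)²·Γ(a+b−c)·Γ(c−a−b)) · (−1)ⁿ/(n!·(c'(ω₀) − a'(ω₀))), where all Gamma arguments on the right are evaluated at ω₀. -/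
open Complex in
/-- The boxed closed-form excitation amplitude factor of the BTZ benchmark
(Eq. 49): `A_n^{(a)} = 1/(C_fast(ω₀)·F'(ω₀))` evaluated along the spectral
branch `c − a = −n`. -/
theorem btz_excitation_amplitude (a b c : ℂ → ℂ) (ω₀ : ℂ) (n : ℕ)
    (ha : DifferentiableAt ℂ a ω₀) (hb : DifferentiableAt ℂ b ω₀)
    (hc : DifferentiableAt ℂ c ω₀)
    (hroot : c ω₀ - a ω₀ = -(n : ℂ))
    (h1 : ∀ k : ℕ, c ω₀ ≠ -(k : ℂ))
    (h2 : ∀ k : ℕ, c ω₀ - a ω₀ - b ω₀ ≠ -(k : ℂ))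
    (h3 : ∀ k : ℕ, c ω₀ - b ω₀ ≠ -(k : ℂ))
    (h4 : ∀ k : ℕ, a ω₀ ≠ -(k : ℂ))
    (h5 : ∀ k : ℕ, b ω₀ ≠ -(k : ℂ))
    (h6 : ∀ k : ℕ, a ω₀ + b ω₀ - c ω₀ ≠ -(k : ℂ))
    (hda : deriv c ω₀ - deriv a ω₀ ≠ 0) :
    1 / ((Gamma (c ω₀) * Gamma (a ω₀ + b ω₀ - c ω₀) / (Gamma (a ω₀) * Gamma (b ω₀))) *
        deriv (fun ω => Gamma (c ω) * Gamma (c ω - a ω - b ω) *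
          (Gamma (c ω - a ω))⁻¹ * (Gamma (c ω - b ω))⁻¹) ω₀) =
      Gamma (a ω₀) * Gamma (b ω₀) * Gamma (c ω₀ - b ω₀) /
          (Gamma (c ω₀) ^ 2 * Gamma (a ω₀ + b ω₀ - c ω₀) * Gamma (c ω₀ - a ω₀ - b ω₀)) *
        ((-1) ^ n / ((n.factorial : ℂ) * (deriv c ω₀ - deriv a ω₀))) := by
  have g1 := Gamma_ne_zero h1
  have g2 := Gamma_ne_zero h2
  have g3 := Gamma_ne_zero h3
  have g4 := Gamma_ne_zero h4
  have g5 := Gamma_ne_zero h5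
  have g6 := Gamma_ne_zero h6
  have d1 : DifferentiableAt ℂ (fun ω => Gamma (c ω)) ω₀ :=
    (differentiableAt_Gamma _ h1).comp ω₀ hc
  have d2 : DifferentiableAt ℂ (fun ω => Gamma (c ω - a ω - b ω)) ω₀ :=
    DifferentiableAt.comp (f := fun ω => c ω - a ω - b ω) ω₀
      (differentiableAt_Gamma _ h2) ((hc.sub ha).sub hb)
  have d3 : DifferentiableAt ℂ (fun ω => (Gamma (c ω - b ω))⁻¹) ω₀ :=
    DifferentiableAt.comp (f := fun ω => c ω - b ω) ω₀
      (differentiable_one_div_Gamma _) (hc.sub hb)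
  have d4 : HasDerivAt (fun ω => (Gamma (c ω - a ω))⁻¹)
      ((-1) ^ n * (n.factorial : ℂ) * (deriv c ω₀ - deriv a ω₀)) ω₀ := by
    have h := hasDerivAt_inv_Gamma_neg_nat n
    rw [← hroot] at h
    exact HasDerivAt.comp (h := fun ω => c ω - a ω) ω₀ h (hc.hasDerivAt.sub ha.hasDerivAt)
  have hF := (((d1.mul d2).hasDerivAt.mul d4).mul d3.hasDerivAt).deriv
  have hF' : deriv (fun ω => Gamma (c ω) * Gamma (c ω - a ω - b ω) *
          (Gamma (c ω - a ω))⁻¹ * (Gamma (c ω - b ω))⁻¹) ω₀ =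
      Gamma (c ω₀) * Gamma (c ω₀ - a ω₀ - b ω₀) *
        ((-1) ^ n * (n.factorial : ℂ) * (deriv c ω₀ - deriv a ω₀)) *
          (Gamma (c ω₀ - b ω₀))⁻¹ := by
    refine hF.trans ?_
    have hz : Gamma (c ω₀ - a ω₀) = 0 := by rw [hroot, Gamma_neg_nat_eq_zero]
    simp [hz]
  rw [hF']
  have hn : (n.factorial : ℂ) ≠ 0 := by exact_mod_cast n.factorial_ne_zero
  have hs : ((-1 : ℂ) ^ n) * (-1) ^ n = 1 := by rw [← mul_pow]; simp
  have hs0 : ((-1 : ℂ) ^ n) ≠ 0 := pow_ne_zero _ (by norm_num)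
  generalize ((-1 : ℂ) ^ n) = e at *
  field_simp
  linear_combination -hs
end

section
/- Let r_h > 0, m ∈ ℝ, ω ∈ ℂ, and set ν := √(1/4 + m²), ρ₀ := −iω/(2r_h), ρ₁ := 1/2 − ν, a := 1/2 − ν, b := 1/2 − ν − iω/r_h, c := 1 − iω/r_h. Let f : ℝ → ℂ be twice differentiable on the open interval (0,1) and satisfy the hypergeometric equation z(1−z)·f''(z) + (c − (a+b+1)z)·f'(z) − a·b·f(z) = 0 for all z ∈ (0,1). Define R(z) := (z : ℂ)^{ρ₀}·((1−z) : ℂ)^{ρ₁}·f(z), using the complex power function. Then for all z ∈ (0,1): z(1−z)·R''(z) + (1−z)·R'(z) + (ω²(1−z)/(4r_h²z) − m²/(1−z))·R(z) = 0. -/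
lemma ads2_hasDerivAt_weight (p q : ℂ) (z : ℝ) (hz : z ∈ Set.Ioo (0 : ℝ) 1) :
    HasDerivAt (fun x : ℝ => (x : ℂ) ^ p * (((1 - x : ℝ)) : ℂ) ^ q)
      ((z : ℂ) ^ p * (((1 - z : ℝ)) : ℂ) ^ q * (p / z - q / (1 - z))) z := by
  obtain ⟨h0, h1⟩ := hz
  have hz0 : (z : ℂ) ≠ 0 := by exact_mod_cast h0.ne'
  have hz1r : (0 : ℝ) < 1 - z := by linarith
  have hz1 : ((1 - z : ℝ) : ℂ) ≠ 0 := by exact_mod_cast hz1r.ne'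
  have hz1' : (1 : ℂ) - z ≠ 0 := by push_cast at hz1; exact hz1
  have e1 : HasDerivAt (fun x : ℝ => (x : ℂ)) 1 z := Complex.ofRealCLM.hasDerivAt
  have e2 : HasDerivAt (fun x : ℝ => ((1 - x : ℝ) : ℂ)) (-1) z := by
    have := e1.const_sub 1
    simpa using this
  have d1 := (Complex.hasStrictDerivAt_cpow_const (c := p)
    (Or.inl (by simpa using h0) : (z : ℂ) ∈ Complex.slitPlane)).hasDerivAt.comp z e1
  have d2 := (Complex.hasStrictDerivAt_cpow_const (c := q)
    (Or.inl (by rw [Complex.ofReal_re]; exact hz1r) :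
      ((1 - z : ℝ) : ℂ) ∈ Complex.slitPlane)).hasDerivAt.comp z e2
  have d := d1.mul d2
  refine d.congr_deriv ?_
  simp only [Function.comp]
  rw [Complex.cpow_sub _ _ hz0, Complex.cpow_sub _ _ hz1, Complex.cpow_one, Complex.cpow_one]
  push_cast
  field_simp
  ring

/-- Hypergeometric reduction of the AdS₂ radial Klein-Gordon equation: if `f`
solves the Gauss hypergeometric equation with parameters `a = 1/2−ν`,
`b = 1/2−ν−iω/r_h`, `c = 1−iω/r_h` on `(0,1)`, then the peeled field
`R(z) = z^{ρ₀}(1−z)^{ρ₁}·f(z)` solves the compactified AdS₂ wave equation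
(Eq. 52). -/
theorem ads2_hypergeometric_reduction (rh m : ℝ) (hrh : 0 < rh) (ω : ℂ)
    (ν : ℝ) (hν : ν = Real.sqrt (1 / 4 + m ^ 2))
    (ρ₀ ρ₁ a b c : ℂ)
    (hρ₀ : ρ₀ = -Complex.I * ω / (2 * rh))
    (hρ₁ : ρ₁ = 1 / 2 - (ν : ℂ))
    (ha : a = 1 / 2 - (ν : ℂ))
    (hb : b = 1 / 2 - (ν : ℂ) - Complex.I * ω / rh)
    (hc : c = 1 - Complex.I * ω / rh)
    (f : ℝ → ℂ)
    (hf1 : ∀ z ∈ Set.Ioo (0 : ℝ) 1, DifferentiableAt ℝ f z)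
    (hf2 : ∀ z ∈ Set.Ioo (0 : ℝ) 1, DifferentiableAt ℝ (deriv f) z)
    (hfeq : ∀ z ∈ Set.Ioo (0 : ℝ) 1,
      (z : ℂ) * (1 - (z : ℂ)) * deriv (deriv f) z +
        (c - (a + b + 1) * (z : ℂ)) * deriv f z - a * b * f z = 0)
    (R : ℝ → ℂ)
    (hR : ∀ z : ℝ, R z = (z : ℂ) ^ ρ₀ * (((1 - z : ℝ)) : ℂ) ^ ρ₁ * f z) :
    ∀ z ∈ Set.Ioo (0 : ℝ) 1,
      (z : ℂ) * (1 - (z : ℂ)) * deriv (deriv R) z + (1 - (z : ℂ)) * deriv R z +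
        (ω ^ 2 * (1 - (z : ℂ)) / (4 * (rh : ℂ) ^ 2 * (z : ℂ)) -
          (m : ℂ) ^ 2 / (1 - (z : ℂ))) * R z = 0 := by
  have hRf : R = fun z : ℝ => (z : ℂ) ^ ρ₀ * (((1 - z : ℝ)) : ℂ) ^ ρ₁ * f z := funext hR
  have hd1 : ∀ z ∈ Set.Ioo (0 : ℝ) 1, HasDerivAt R
      ((z : ℂ) ^ ρ₀ * (((1 - z : ℝ)) : ℂ) ^ ρ₁ *
        (deriv f z + (ρ₀ / z - ρ₁ / (1 - z)) * f z)) z := by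
    intro z hz
    rw [hRf]
    refine ((ads2_hasDerivAt_weight ρ₀ ρ₁ z hz).mul (hf1 z hz).hasDerivAt).congr_deriv ?_
    ring
  intro z hz
  have hz0 : (z : ℂ) ≠ 0 := by exact_mod_cast hz.1.ne'
  have hz1 : (1 : ℂ) - z ≠ 0 := by
    have : (1 - z : ℝ) ≠ 0 := by linarith [hz.2]
    exact_mod_cast this
  have hr : (rh : ℂ) ≠ 0 := by exact_mod_cast hrh.ne'
  have e1 : HasDerivAt (fun x : ℝ => (x : ℂ)) 1 z := Complex.ofRealCLM.hasDerivAt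
  have hp : HasDerivAt (fun x : ℝ => ρ₀ / (x : ℂ) - ρ₁ / (1 - (x : ℂ)))
      (-ρ₀ / z ^ 2 - ρ₁ / (1 - z) ^ 2) z := by
    refine (((hasDerivAt_const z ρ₀).div e1 hz0).sub
      ((hasDerivAt_const z ρ₁).div (e1.const_sub 1) hz1)).congr_deriv ?_
    ring
  have hd2 : deriv (deriv R) z = (z : ℂ) ^ ρ₀ * (((1 - z : ℝ)) : ℂ) ^ ρ₁ *
      ((ρ₀ / z - ρ₁ / (1 - z)) * (deriv f z + (ρ₀ / z - ρ₁ / (1 - z)) * f z) +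
        (deriv (deriv f) z + ((-ρ₀ / z ^ 2 - ρ₁ / (1 - z) ^ 2) * f z +
          (ρ₀ / z - ρ₁ / (1 - z)) * deriv f z))) := by
    have hev : deriv R =ᶠ[nhds z] fun z : ℝ => ((z : ℂ) ^ ρ₀ * (((1 - z : ℝ)) : ℂ) ^ ρ₁) *
        (deriv f z + (ρ₀ / z - ρ₁ / (1 - z)) * f z) := by
      filter_upwards [isOpen_Ioo.mem_nhds hz] with x hx
      exact (hd1 x hx).deriv
    rw [hev.deriv_eq]
    refine HasDerivAt.deriv ?_
    refine ((ads2_hasDerivAt_weight ρ₀ ρ₁ z hz).mul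
      ((hf2 z hz).hasDerivAt.add (hp.mul (hf1 z hz).hasDerivAt))).congr_deriv ?_
    simp only [Pi.add_apply, Pi.mul_apply]
    ring
  have hm : (m : ℂ) ^ 2 = ρ₁ ^ 2 - ρ₁ := by
    have h : ν ^ 2 = 1 / 4 + m ^ 2 := by rw [hν, Real.sq_sqrt (by positivity)]
    have h' : (ν : ℂ) ^ 2 = 1 / 4 + (m : ℂ) ^ 2 := by
      have := congrArg Complex.ofReal h
      push_cast at this
      exact this
    rw [hρ₁]
    linear_combination -h'
  have hω : ω ^ 2 * (1 - (z : ℂ)) / (4 * (rh : ℂ) ^ 2 * (z : ℂ)) = -ρ₀ ^ 2 * (1 - z) / z := by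
    rw [hρ₀]
    field_simp
    rw [Complex.I_sq]
    ring
  have hI : Complex.I * ω / rh = -2 * ρ₀ := by
    rw [hρ₀]
    field_simp
  have hE := hfeq z hz
  rw [hc, ha, hb, hI, ← hρ₁] at hE
  rw [hd2, (hd1 z hz).deriv, hR z, hω, hm]
  generalize (z : ℂ) ^ ρ₀ * (((1 - z : ℝ)) : ℂ) ^ ρ₁ = W
  have key : (z : ℂ) * (1 - z) * ((ρ₀ / z - ρ₁ / (1 - z)) ^ 2
      + (-ρ₀ / z ^ 2 - ρ₁ / (1 - z) ^ 2)) + (1 - z) * (ρ₀ / z - ρ₁ / (1 - z))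
      + (-ρ₀ ^ 2 * (1 - z) / z - (ρ₁ ^ 2 - ρ₁) / (1 - z)) = -ρ₁ * (ρ₁ + 2 * ρ₀) := by
    field_simp
    ring
  have key2 : (z : ℂ) * (1 - z) * (ρ₀ / z - ρ₁ / (1 - z)) = ρ₀ * (1 - z) - ρ₁ * z := by
    field_simp
  linear_combination W * hE + W * f z * key + 2 * W * deriv f z * key2
end

section
/- Let κ > 0, V₀ ∈ ℝ, ω ∈ ℂ, and let Ψ : ℝ → ℂ be twice differentiable on the open interval (0,1) satisfying, for all z ∈ (0,1), z(1−z)·Ψ''(z) + (1−2z)·Ψ'(z) + (ω²/(4κ²z(1−z)) − V₀/κ²)·Ψ(z) = 0. Define Φ : ℝ → ℂ by Φ(x) := Ψ((1 + tanh(κx))/2). Then Φ is twice differentiable on ℝ and satisfies Φ''(x) + (ω² − V₀/cosh²(κx))·Φ(x) = 0 for all x ∈ ℝ. -/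
/-- Exact correspondence between the compactified rational form (Eq. 64) and the
Pöschl–Teller wave equation (Eq. 61) under `z = (1 + tanh(κx))/2`. -/
theorem poschl_teller_correspondence (κ V₀ : ℝ) (hκ : 0 < κ) (ω : ℂ)
    (Ψ : ℝ → ℂ)
    (hΨ1 : ∀ z ∈ Set.Ioo (0 : ℝ) 1, DifferentiableAt ℝ Ψ z)
    (hΨ2 : ∀ z ∈ Set.Ioo (0 : ℝ) 1, DifferentiableAt ℝ (deriv Ψ) z)
    (heq : ∀ z ∈ Set.Ioo (0 : ℝ) 1,
      (z : ℂ) * (1 - (z : ℂ)) * deriv (deriv Ψ) z +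
        (1 - 2 * (z : ℂ)) * deriv Ψ z +
        (ω ^ 2 / (4 * (κ : ℂ) ^ 2 * (z : ℂ) * (1 - (z : ℂ))) -
          (V₀ : ℂ) / (κ : ℂ) ^ 2) * Ψ z = 0)
    (Φ : ℝ → ℂ)
    (hΦ : ∀ x : ℝ, Φ x = Ψ ((1 + Real.tanh (κ * x)) / 2)) :
    (∀ x : ℝ, DifferentiableAt ℝ Φ x) ∧
    (∀ x : ℝ, DifferentiableAt ℝ (deriv Φ) x) ∧
    ∀ x : ℝ, deriv (deriv Φ) x +
      (ω ^ 2 - (V₀ : ℂ) / ((Real.cosh (κ * x) : ℂ)) ^ 2) * Φ x = 0 := by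
  obtain ⟨z, hz⟩ : ∃ z : ℝ → ℝ, ∀ x, z x = (1 + Real.tanh (κ * x)) / 2 := ⟨_, fun _ => rfl⟩
  have hzf : z = fun x => (1 + Real.sinh (κ * x) / Real.cosh (κ * x)) / 2 := by
    funext x
    rw [hz, Real.tanh_eq_sinh_div_cosh]
  have hcosh : ∀ x : ℝ, 4 * (z x * (1 - z x)) * Real.cosh (κ * x) ^ 2 = 1 := by
    intro x
    have hc := (Real.cosh_pos (κ * x)).ne'
    have hs := Real.cosh_sq (κ * x)
    rw [hzf]
    field_simp
    linear_combination 4 * hs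
  have hmem : ∀ x, z x ∈ Set.Ioo (0 : ℝ) 1 := by
    intro x
    have h1 := hcosh x
    have hc : 0 < Real.cosh (κ * x) ^ 2 := pow_pos (Real.cosh_pos _) 2
    have hp : 0 < z x * (1 - z x) := by
      by_contra hneg
      push Not at hneg
      nlinarith
    constructor <;> nlinarith
  have hzd : ∀ x, HasDerivAt z (2 * κ * (z x * (1 - z x))) x := by
    intro x
    have hc := (Real.cosh_pos (κ * x)).ne'
    have hk : HasDerivAt (fun x : ℝ => κ * x) κ x := by
      simpa using (hasDerivAt_id x).const_mul κ
    have h := (((hk.sinh).div (hk.cosh) hc).const_add 1).div_const 2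
    have h2 := hcosh x
    have hs := Real.cosh_sq (κ * x)
    rw [hzf] at h2 ⊢
    refine h.congr_deriv ?_
    field_simp
    ring
  have hΦ' : Φ = fun x => Ψ (z x) := by
    funext x
    rw [hΦ, hz]
  have hd1 : ∀ x, HasDerivAt Φ ((2 * κ * (z x * (1 - z x))) • deriv Ψ (z x)) x := by
    intro x
    rw [hΦ']
    exact (hΨ1 _ (hmem x)).hasDerivAt.scomp x (hzd x)
  have hdf : deriv Φ = fun x => (2 * κ * (z x * (1 - z x))) • deriv Ψ (z x) :=
    funext fun x => (hd1 x).deriv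
  have hd2 : ∀ x, HasDerivAt (deriv Φ)
      ((2 * κ * (z x * (1 - z x))) • ((2 * κ * (z x * (1 - z x))) • deriv (deriv Ψ) (z x)) +
      (2 * κ * ((2 * κ * (z x * (1 - z x))) * (1 - 2 * z x))) • deriv Ψ (z x)) x := by
    intro x
    rw [hdf]
    have ha : HasDerivAt (fun x => 2 * κ * (z x * (1 - z x)))
        (2 * κ * ((2 * κ * (z x * (1 - z x))) * (1 - 2 * z x))) x := by
      refine (((hzd x).mul ((hzd x).const_sub 1)).const_mul (2 * κ)).congr_deriv ?_
      ring
    exact ha.smul ((hΨ2 _ (hmem x)).hasDerivAt.scomp x (hzd x))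
  refine ⟨fun x => (hd1 x).differentiableAt, fun x => (hd2 x).differentiableAt, fun x => ?_⟩
  rw [(hd2 x).deriv, hΦ']
  have he := heq _ (hmem x)
  have h1 : (4 : ℂ) * ((z x : ℂ) * (1 - (z x : ℂ))) * (Real.cosh (κ * x) : ℂ) ^ 2 = 1 := by
    exact_mod_cast hcosh x
  have hc : (Real.cosh (κ * x) : ℂ) ≠ 0 := by
    exact_mod_cast (Real.cosh_pos (κ * x)).ne'
  have hk : (κ : ℂ) ≠ 0 := by exact_mod_cast hκ.ne'
  have hz0 : (z x : ℂ) ≠ 0 := by exact_mod_cast (hmem x).1.ne'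
  have hz1 : (1 - (z x : ℂ)) ≠ 0 := by
    have := sub_pos.2 (hmem x).2
    exact_mod_cast this.ne'
  have hV : (V₀ : ℂ) / (Real.cosh (κ * x) : ℂ) ^ 2
      = 4 * ((z x : ℂ) * (1 - (z x : ℂ))) * V₀ := by
    rw [div_eq_iff (pow_ne_zero 2 hc)]
    linear_combination (-(V₀ : ℂ)) * h1
  rw [hV]
  simp only [Complex.real_smul]
  push_cast
  have hw : 4 * (κ : ℂ) ^ 2 * ((z x : ℂ) * (1 - (z x : ℂ))) *
      (ω ^ 2 / (4 * (κ : ℂ) ^ 2 * (z x : ℂ) * (1 - (z x : ℂ))) - (V₀ : ℂ) / (κ : ℂ) ^ 2)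
      = ω ^ 2 - 4 * ((z x : ℂ) * (1 - (z x : ℂ))) * V₀ := by
    field_simp
  rw [← hw]
  linear_combination (4 * (κ : ℂ) ^ 2 * ((z x : ℂ) * (1 - (z x : ℂ)))) * he
end

section
/- Let κ > 0 be real, let s ∈ ℂ, and for ω ∈ ℂ define a(ω) := 1/2 − iω/κ + s/2, b(ω) := 1/2 − iω/κ − s/2, c(ω) := 1 − iω/κ. Suppose Γ(c(ω)) ≠ 0 and Γ(a(ω)+b(ω)−c(ω)) ≠ 0. Then Γ(c(ω))·Γ(a(ω)+b(ω)−c(ω))/(Γ(a(ω))·Γ(b(ω))) = 0 if and only if there exists a natural number n such that ω = −iκ(n + 1/2 + s/2) or ω = −iκ(n + 1/2 − s/2). -/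
open Complex in
/-- Exact Pöschl–Teller quasinormal spectrum (Eq. 73): the outgoing quantization
function `F_{0,1} = C_fast = Γ(c)Γ(a+b−c)/(Γ(a)Γ(b))` vanishes exactly at the
frequencies `ω = −iκ(n + 1/2 ± s/2)`. -/
theorem poschl_teller_spectrum (κ : ℝ) (hκ : 0 < κ) (s ω : ℂ)
    (a b c : ℂ)
    (ha : a = 1 / 2 - Complex.I * ω / κ + s / 2)
    (hb : b = 1 / 2 - Complex.I * ω / κ - s / 2)
    (hc : c = 1 - Complex.I * ω / κ)
    (hΓc : Gamma c ≠ 0) (hΓabc : Gamma (a + b - c) ≠ 0) :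
    Gamma c * Gamma (a + b - c) / (Gamma a * Gamma b) = 0 ↔
      ∃ n : ℕ, ω = -Complex.I * κ * ((n : ℂ) + 1 / 2 + s / 2) ∨
        ω = -Complex.I * κ * ((n : ℂ) + 1 / 2 - s / 2) := by
  have hk : (κ : ℂ) ≠ 0 := by exact_mod_cast hκ.ne'
  have key : ∀ z : ℂ, Complex.I * ω / κ = z ↔ ω = -Complex.I * κ * z := by
    intro z
    rw [div_eq_iff hk]
    constructor
    · intro h
      linear_combination (-Complex.I) * h + ω * Complex.I_mul_I
    · intro h
      rw [h]
      linear_combination (-(κ : ℂ) * z) * Complex.I_mul_I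
  have h1 : Gamma c * Gamma (a + b - c) / (Gamma a * Gamma b) = 0 ↔
      Gamma a = 0 ∨ Gamma b = 0 := by
    simp [div_eq_zero_iff, hΓc, hΓabc]
  rw [h1, Complex.Gamma_eq_zero_iff, Complex.Gamma_eq_zero_iff, ← exists_or]
  refine exists_congr fun n => or_congr ?_ ?_
  · rw [← key, ha]
    constructor <;> intro h <;> linear_combination -h
  · rw [← key, hb]
    constructor <;> intro h <;> linear_combination -h
end
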